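/- Assume that for each fixed (x,t) the map z ↦ φ(x,t,z) takes at most finitely many values, and assume that B is LCP at every point of (0,∞)ⁿ × [0,T]. Then for each i = 1,…,n and each fixed time t ∈ [0,T], the jump volatility of the i-th asset, x ↦ √( λ(t)² ∫₀¹ φ_i(x,t,z)² dz / x_i² ), is nondecreasing as a function of x_i (with the other coordinates of x held fixed). -/

import Mathlib

open MeasureTheory Set Matrix NNReal

noncomputable section

/-- The open positive orthant `(0,∞)ⁿ` in `ℝⁿ`. -/
def posOrth (n : ℕ) : Set (Fin n → ℝ) := {x | ∀ i, 0 < x i}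

/-- First directional derivative of `f` at `x` in direction `v`. -/
def dir1 {n : ℕ} {F : Type*} [NormedAddCommGroup F] [NormedSpace ℝ F]
    (f : (Fin n → ℝ) → F) (x v : Fin n → ℝ) : F :=
  fderiv ℝ f x v

/-- Mixed second derivative: differentiate `f` in direction `v`, then in direction `w`. -/
def dmix {n : ℕ} {F : Type*} [NormedAddCommGroup F] [NormedSpace ℝ F]
    (f : (Fin n → ℝ) → F) (x v w : Fin n → ℝ) : F :=
  fderiv ℝ (fun y => fderiv ℝ f y v) x w

/-- Second directional derivative of `f` at `x` in direction `v`. -/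
def dir2 {n : ℕ} {F : Type*} [NormedAddCommGroup F] [NormedSpace ℝ F]
    (f : (Fin n → ℝ) → F) (x v : Fin n → ℝ) : F :=
  dmix f x v v

/-- The class `F` of test functions: `C⁴` on the positive orthant, with locally Hölder
continuous fourth derivatives, and with `f` together with its derivatives up to order two
of at most polynomial growth. -/
structure MemTestClass (n : ℕ) (f : (Fin n → ℝ) → ℝ) : Prop where
  smooth : ContDiffOn ℝ 4 f (posOrth n)
  holder4 : ∃ α : ℝ≥0, 0 < α ∧ (α : ℝ) ≤ 1 ∧
    ∀ x ∈ posOrth n, ∃ s ∈ nhds x, s ⊆ posOrth n ∧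
      ∃ C : ℝ≥0, HolderOnWith C α (iteratedFDeriv ℝ 4 f) s
  polyGrowth : ∃ C m : ℝ, ∀ x ∈ posOrth n, ∀ k : ℕ, k ≤ 2 →
    ‖iteratedFDeriv ℝ k f x‖ ≤ C * (1 + ‖x‖ ^ m)

/-- The jump structure `φ(x,t,z)` together with the standing assumptions (A3), (A6), (A7). -/
structure JumpKernel (n : ℕ) (T : ℝ) where
  φ : (Fin n → ℝ) → ℝ → ℝ → (Fin n → ℝ)
  meas : ∀ x ∈ posOrth n, ∀ t ∈ Icc (0:ℝ) T, Measurable (fun z => φ x t z)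
  smooth : ∀ t ∈ Icc (0:ℝ) T, ∀ z ∈ Icc (0:ℝ) 1,
    ContDiffOn ℝ 2 (fun x => φ x t z) (posOrth n)
  holder2 : ∃ α : ℝ≥0, 0 < α ∧ (α : ℝ) ≤ 1 ∧
    ∀ t ∈ Icc (0:ℝ) T, ∀ x ∈ posOrth n, ∃ s ∈ nhds x, s ⊆ posOrth n ∧
      ∃ C : ℝ≥0, ∀ z ∈ Icc (0:ℝ) 1,
        HolderOnWith C α (iteratedFDeriv ℝ 2 (fun y => φ y t z)) s
  bound : ∃ D : ℝ, 0 < D ∧ ∀ x ∈ posOrth n, ∀ t ∈ Icc (0:ℝ) T, ∀ z ∈ Icc (0:ℝ) 1,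
    ∀ i, (φ x t z i) ^ 2 ≤ D * (x i) ^ 2
  lower : ∃ γ₀ : ℝ, -1 < γ₀ ∧ ∀ x ∈ posOrth n, ∀ t ∈ Icc (0:ℝ) T, ∀ z ∈ Icc (0:ℝ) 1,
    ∀ i, γ₀ * x i < φ x t z i

/-- For each fixed `(x,t)`, `φ(x,t,z) ≠ 0` for almost every `z ∈ [0,1]`. -/
def JumpKernel.AENonzero {n : ℕ} {T : ℝ} (K : JumpKernel n T) : Prop :=
  ∀ x ∈ posOrth n, ∀ t ∈ Icc (0:ℝ) T,
    ∀ᵐ z ∂(volume.restrict (Icc (0:ℝ) 1)), K.φ x t z ≠ 0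

/-- The jump intensity `λ` : nonnegative and Hölder continuous on `[0,T]`. -/
def LamOK (T : ℝ) (lam : ℝ → ℝ) : Prop :=
  (∀ t ∈ Icc (0:ℝ) T, 0 ≤ lam t) ∧
  ∃ α C : ℝ≥0, 0 < α ∧ (α : ℝ) ≤ 1 ∧ HolderOnWith C α lam (Icc (0:ℝ) T)

/-- The integro-differential jump operator `B`. -/
def Bop {n : ℕ} {T : ℝ} (lam : ℝ → ℝ) (K : JumpKernel n T)
    (f : (Fin n → ℝ) → ℝ) (x : Fin n → ℝ) (t : ℝ) : ℝ :=
  lam t * ∫ z in Icc (0:ℝ) 1,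
    (f (x + K.φ x t z) - f x - fderiv ℝ f x (K.φ x t z))

/-- The diffusion matrix `β(x,t)` together with the standing assumptions (A1), (A3), (A5). -/
structure DiffKernel (n : ℕ) (T : ℝ) where
  β : (Fin n → ℝ) → ℝ → Matrix (Fin n) (Fin n) ℝ
  smooth : ∀ t ∈ Icc (0:ℝ) T, ∀ i j, ContDiffOn ℝ 2 (fun x => β x t i j) (posOrth n)
  holder2 : ∃ α : ℝ≥0, 0 < α ∧ (α : ℝ) ≤ 1 ∧
    ∀ t ∈ Icc (0:ℝ) T, ∀ i j, ∀ x ∈ posOrth n, ∃ s ∈ nhds x, s ⊆ posOrth n ∧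
      ∃ C : ℝ≥0, HolderOnWith C α (iteratedFDeriv ℝ 2 (fun y => β y t i j)) s
  nonsing : ∀ x ∈ posOrth n, ∀ t ∈ Icc (0:ℝ) T, (β x t).det ≠ 0
  bound : ∃ D : ℝ, 0 < D ∧ ∀ x ∈ posOrth n, ∀ t ∈ Icc (0:ℝ) T,
    ∀ i, ∑ j, (β x t i j) ^ 2 ≤ D * (x i) ^ 2

/-- The second order differential operator `A` with coefficient matrix `a = ββ*/2`. -/
def Aop {n : ℕ} {T : ℝ} (Dk : DiffKernel n T)
    (f : (Fin n → ℝ) → ℝ) (x : Fin n → ℝ) (t : ℝ) : ℝ :=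
  ∑ i, ∑ j, ((Dk.β x t * (Dk.β x t)ᵀ) i j / 2) *
    dmix f x (Pi.single i 1) (Pi.single j 1)

/-- An operator `D` (mapping a test function `f` to a function of `(x,t)`) is locally
convexity preserving (LCP) at `(x,t)` if `∂_v²(Df)(x,t) ≥ 0` for every direction `v ≠ 0`
and every convex `f ∈ F` with `∂_v²f(x) = 0`. -/
def IsLCPAt {n : ℕ} (D : ((Fin n → ℝ) → ℝ) → (Fin n → ℝ) → ℝ → ℝ)
    (x : Fin n → ℝ) (t : ℝ) : Prop :=
  ∀ v : Fin n → ℝ, v ≠ 0 → ∀ f : (Fin n → ℝ) → ℝ,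
    MemTestClass n f → ConvexOn ℝ (posOrth n) f → dir2 f x v = 0 →
    0 ≤ dir2 (fun y => D f y t) x v

/-- The integrand in condition (ohly) of Theorem 5.1. -/
def ohlyIntegrand {n : ℕ} {T : ℝ} (K : JumpKernel n T)
    (f : (Fin n → ℝ) → ℝ) (x v : Fin n → ℝ) (t z : ℝ) : ℝ :=
  dmix f (x + K.φ x t z) v v
    + 2 * dmix f (x + K.φ x t z) v (dir1 (fun y => K.φ y t z) x v)
    + dmix f (x + K.φ x t z) (dir1 (fun y => K.φ y t z) x v)
        (dir1 (fun y => K.φ y t z) x v)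
    + (fderiv ℝ f (x + K.φ x t z) (dir2 (fun y => K.φ y t z) x v)
        - fderiv ℝ f x (dir2 (fun y => K.φ y t z) x v))


open scoped ContDiff in
lemma exists_bound_deriv_smoothTransition :
    ∃ C, ∀ y, |deriv Real.smoothTransition y| ≤ C := by
  have hc : Continuous (deriv Real.smoothTransition) :=
    (Real.smoothTransition.contDiff (n := ⊤)).continuous_deriv (by simp)
  obtain ⟨C, hC⟩ := isCompact_Icc.exists_bound_of_continuousOn (s := Icc (0:ℝ) 1) hc.continuousOn
  have hC0 : 0 ≤ C := (norm_nonneg _).trans (hC 0 (by simp))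
  refine ⟨C, fun y => ?_⟩
  by_cases hy : y ∈ Icc (0:ℝ) 1
  · exact hC y hy
  · suffices h : deriv Real.smoothTransition y = 0 by simpa [h]
    rw [mem_Icc, not_and_or, not_le, not_le] at hy
    rcases hy with hy | hy
    · refine IsLocalMin.deriv_eq_zero (Filter.Eventually.of_forall fun u => ?_)
      rw [Real.smoothTransition.zero_of_nonpos hy.le]
      exact Real.smoothTransition.nonneg u
    · refine IsLocalMax.deriv_eq_zero (Filter.Eventually.of_forall fun u => ?_)
      rw [Real.smoothTransition.one_of_one_le hy.le]
      exact Real.smoothTransition.le_one u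

open scoped ContDiff in
/-- A bounded smooth nondecreasing function which is the identity on a given finite set, with
vanishing derivative there, and is constant to the right of a given upper bound. -/
lemma exists_smooth_monotone_interp (S : Finset ℝ) : ∀ c : ℝ, (∀ a ∈ S, a ≤ c) →
    ∃ m : ℝ → ℝ, ContDiff ℝ ∞ m ∧ Monotone m ∧ (∃ C, ∀ y, |m y| ≤ C ∧ |deriv m y| ≤ C) ∧
      (∀ a ∈ S, m a = a ∧ deriv m a = 0) ∧ ∀ y, c ≤ y → m y = c := by
  classical
  induction S using Finset.induction_on_max with
  | empty =>
    intro c _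
    exact ⟨fun _ => c, contDiff_const, monotone_const, ⟨|c|, fun y => by simp⟩, by simp, by simp⟩
  | insert b S hb ih =>
    intro c hc
    obtain ⟨m, hm, hmono, ⟨C, hC⟩, hS, hconst⟩ := ih b fun a ha => (hb a ha).le
    have hbc : b ≤ c := hc b (by simp)
    rcases hbc.eq_or_lt with rfl | hbc
    · refine ⟨m, hm, hmono, ⟨C, hC⟩, ?_, hconst⟩
      intro a ha
      rcases Finset.mem_insert.1 ha with rfl | ha
      · refine ⟨hconst a le_rfl, IsLocalMax.deriv_eq_zero (Filter.Eventually.of_forall fun u => ?_)⟩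
        rcases le_total u a with h | h
        · exact hmono h
        · simp [hconst u h, hconst a le_rfl]
      · exact hS a ha
    obtain ⟨L, hL⟩ := exists_bound_deriv_smoothTransition
    set d := c - b with hd
    have hd0 : 0 < d := sub_pos.2 hbc
    set τ : ℝ → ℝ := fun y => d * Real.smoothTransition ((y - b) / d) with hτ
    have hσ : ContDiff ℝ ∞ Real.smoothTransition := Real.smoothTransition.contDiff (n := ⊤)
    have hτs : ContDiff ℝ ∞ τ := contDiff_const.mul (hσ.comp (by fun_prop))
    have hτd : ∀ y, deriv τ y = deriv Real.smoothTransition ((y - b) / d) := by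
      intro y
      have h1 : HasDerivAt (fun y : ℝ => (y - b) / d) (1 / d) y :=
        ((hasDerivAt_id y).sub_const b).div_const d
      have h2 := ((hσ.differentiable (by simp)) ((y - b) / d)).hasDerivAt
      have h3 := h2.comp y h1
      have h4 : HasDerivAt τ (d * (deriv Real.smoothTransition ((y - b) / d) * (1 / d))) y :=
        h3.const_mul d
      rw [h4.deriv]
      field_simp
    have hτ0 : ∀ y, 0 ≤ τ y := fun y => mul_nonneg hd0.le (Real.smoothTransition.nonneg _)
    have hτz : ∀ y, y ≤ b → τ y = 0 := fun y hy => by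
      simp only [hτ]
      rw [Real.smoothTransition.zero_of_nonpos (div_nonpos_of_nonpos_of_nonneg (by linarith) hd0.le),
        mul_zero]
    have hτdz : ∀ y, y ≤ b → deriv τ y = 0 := fun y hy =>
      IsLocalMin.deriv_eq_zero (Filter.Eventually.of_forall fun u => by
        rw [hτz y hy]; exact hτ0 u)
    have hadd : ∀ y, deriv (fun y => m y + τ y) y = deriv m y + deriv τ y := fun y =>
      deriv_add (hm.differentiable (by simp) y) (hτs.differentiable (by simp) y)
    refine ⟨fun y => m y + τ y, hm.add hτs, ?_, ⟨C + d + L, fun y => ?_⟩, ?_, ?_⟩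
    · intro y y' h
      have : τ y ≤ τ y' := mul_le_mul_of_nonneg_left
        (Real.smoothTransition.monotone (by gcongr)) hd0.le
      exact add_le_add (hmono h) this
    · have hL0 : 0 ≤ L := (abs_nonneg _).trans (hL 0)
      have h1 : |τ y| ≤ d := by
        rw [abs_of_nonneg (hτ0 y)]
        exact mul_le_of_le_one_right hd0.le (Real.smoothTransition.le_one _)
      rw [hadd, hτd]
      have := hL ((y - b) / d)
      constructor
      · refine (abs_add_le _ _).trans ?_
        linarith [(hC y).1]
      · refine (abs_add_le _ _).trans ?_
        linarith [(hC y).2]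
    · intro a ha
      rw [hadd]
      change m a + τ a = a ∧ _
      rcases Finset.mem_insert.1 ha with rfl | ha
      · refine ⟨by simp [hconst a le_rfl, hτz a le_rfl], ?_⟩
        rw [hτdz a le_rfl, add_zero]
        refine IsLocalMax.deriv_eq_zero (Filter.Eventually.of_forall fun u => ?_)
        rcases le_total u a with h | h
        · exact hmono h
        · simp [hconst u h, hconst a le_rfl]
      · rw [hτz a (hb a ha).le, hτdz a (hb a ha).le, add_zero, add_zero]
        exact hS a ha
    · intro y hy
      have : (1:ℝ) ≤ (y - b) / d := by rw [one_le_div hd0]; linarith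
      simp only [hτ]
      rw [hconst y (by linarith), Real.smoothTransition.one_of_one_le this]
      linarith

open scoped ContDiff in
/-- A smooth convex function of at most linear growth whose second derivative vanishes on a given
finite set, and whose first derivative is the identity on that set. -/
lemma exists_smooth_convex_interp (S : Finset ℝ) :
    ∃ F : ℝ → ℝ, ContDiff ℝ ∞ F ∧ Monotone (deriv F) ∧
      (∃ C, ∀ y, |F y| ≤ C * |y| ∧ |deriv F y| ≤ C ∧ |deriv (deriv F) y| ≤ C) ∧
      ∀ a ∈ S, deriv F a = a ∧ deriv (deriv F) a = 0 := by
  obtain ⟨c, hc⟩ := S.bddAbove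
  obtain ⟨m, hm, hmono, ⟨C, hC⟩, hS, -⟩ := exists_smooth_monotone_interp S c fun a ha => hc ha
  have hd : ∀ y, HasDerivAt (fun y => ∫ u in (0:ℝ)..y, m u) (m y) y := fun y =>
    intervalIntegral.integral_hasDerivAt_right (hm.continuous.intervalIntegrable _ _)
      (hm.continuous.stronglyMeasurableAtFilter _ _) hm.continuous.continuousAt
  have hd' : deriv (fun y => ∫ u in (0:ℝ)..y, m u) = m := funext fun y => (hd y).deriv
  refine ⟨fun y => ∫ u in (0:ℝ)..y, m u, ?_, by rwa [hd'], ⟨C, fun y => ?_⟩, by rwa [hd']⟩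
  · exact contDiff_infty_iff_deriv.2 ⟨fun y => (hd y).differentiableAt, by rwa [hd']⟩
  · rw [hd']
    refine ⟨?_, hC y⟩
    have := intervalIntegral.norm_integral_le_of_norm_le_const (a := 0) (b := y) (f := m) (C := C)
      fun u _ => (hC u).1
    simpa using this

lemma isOpen_posOrth (n : ℕ) : IsOpen (posOrth n) := by
  have : posOrth n = ⋂ i, {x | 0 < x i} := by ext; simp [posOrth]
  rw [this]
  exact isOpen_iInter_of_finite fun i => isOpen_lt continuous_const (continuous_apply i)

lemma convex_posOrth (n : ℕ) : Convex ℝ (posOrth n) := by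
  intro x hx y hy a b ha hb hab i
  have := (convex_Ioi (0:ℝ)) (hx i) (hy i) ha hb hab
  simpa using this

open scoped ContDiff in
lemma memTestClass_comp_apply {n : ℕ} (i : Fin n) {F : ℝ → ℝ} (hF : ContDiff ℝ ∞ F)
    (hC : ∃ C, ∀ y, |F y| ≤ C * |y| ∧ |deriv F y| ≤ C ∧ |deriv (deriv F) y| ≤ C) :
    MemTestClass n (fun y => F (y i)) := by
  have hf : ContDiff ℝ ∞ (fun y : Fin n → ℝ => F (y i)) := hF.comp (contDiff_apply ℝ ℝ i)
  refine ⟨(contDiff_infty.1 hf 4).contDiffOn, ⟨1, one_pos, by simp, fun x hx => ?_⟩, ?_⟩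
  · have h1 : ContDiff ℝ 1 (iteratedFDeriv ℝ 4 fun y : Fin n → ℝ => F (y i)) :=
      (contDiff_infty.1 hf 5).iteratedFDeriv_right (by norm_num)
    obtain ⟨C, s, hs, h⟩ := h1.contDiffAt.exists_lipschitzOnWith (x := x)
    refine ⟨s ∩ posOrth n, Filter.inter_mem hs ((isOpen_posOrth n).mem_nhds hx),
      inter_subset_right, C, ?_⟩
    exact holderOnWith_one.2 (h.mono inter_subset_left)
  · obtain ⟨C, hC⟩ := hC
    refine ⟨C, 1, fun x _ k hk => ?_⟩
    have hC0 : 0 ≤ C := (abs_nonneg _).trans (hC 0).2.1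
    have hx : |x i| ≤ ‖x‖ := norm_le_pi_norm x i
    have h1 : ‖iteratedFDeriv ℝ k (fun y : Fin n → ℝ => F (y i)) x‖ ≤ |iteratedDeriv k F (x i)| := by
      have := (ContinuousLinearMap.proj (R := ℝ) (φ := fun _ : Fin n => ℝ) i).iteratedFDeriv_comp_right
        hF x (i := k) (by exact_mod_cast le_top)
      have h2 : (F ∘ (ContinuousLinearMap.proj (R := ℝ) (φ := fun _ : Fin n => ℝ) i)) =
        fun y : Fin n → ℝ => F (y i) := rfl
      rw [h2] at this
      rw [this]
      refine (ContinuousMultilinearMap.norm_compContinuousLinearMap_le _ _).trans ?_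
      rw [norm_iteratedFDeriv_eq_norm_iteratedDeriv]
      refine mul_le_of_le_one_right (norm_nonneg _) (Finset.prod_le_one (fun _ _ => norm_nonneg _) ?_)
      intro _ _
      refine ContinuousLinearMap.opNorm_le_bound _ zero_le_one fun y => ?_
      rw [one_mul]
      exact norm_le_pi_norm y i
    refine h1.trans ?_
    rw [Real.rpow_one]
    have hx0 := norm_nonneg x
    interval_cases k
    · rw [iteratedDeriv_zero]
      nlinarith [(hC (x i)).1]
    · rw [iteratedDeriv_one]
      nlinarith [(hC (x i)).2.1]
    · rw [iteratedDeriv_succ, iteratedDeriv_one]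
      nlinarith [(hC (x i)).2.2]

open scoped ContDiff in
lemma convexOn_comp_apply {n : ℕ} (i : Fin n) {F : ℝ → ℝ} (hF : ContDiff ℝ ∞ F)
    (hmono : Monotone (deriv F)) : ConvexOn ℝ (posOrth n) (fun y => F (y i)) := by
  have h := (hmono.convexOn_univ_of_deriv (hF.differentiable (by simp))).comp_linearMap
    (LinearMap.proj (R := ℝ) (φ := fun _ : Fin n => ℝ) i)
  exact h.subset (subset_univ _) (convex_posOrth n)

/-- A bound on a `C²` function and on the oscillation of its second derivative bounds the first
two derivatives. -/
lemma norm_fderiv_le_of_osc {E : Type*} [NormedAddCommGroup E] [NormedSpace ℝ E] {ψ : E → ℝ}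
    {x : E} {r M C : ℝ} (hr : 0 < r) (hC0 : 0 ≤ C)
    (hψ : ContDiffOn ℝ 2 ψ (Metric.ball x (4 * r)))
    (hM : ∀ y ∈ Metric.ball x (4 * r), |ψ y| ≤ M)
    (hC : ∀ y ∈ Metric.ball x (4 * r), ∀ y' ∈ Metric.ball x (4 * r), ∀ v w,
      |fderiv ℝ (fderiv ℝ ψ) y w v - fderiv ℝ (fderiv ℝ ψ) y' w v| ≤ C * ‖w‖ * ‖v‖) :
    (∀ y ∈ Metric.ball x (2 * r), ‖fderiv ℝ (fderiv ℝ ψ) y‖ ≤ 4 * M / r ^ 2 + C) ∧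
      ∀ y ∈ Metric.ball x r, ‖fderiv ℝ ψ y‖ ≤ 2 * M / r + (4 * M / r ^ 2 + C) * r := by
  have hd1 : ∀ y ∈ Metric.ball x (4 * r), HasFDerivAt ψ (fderiv ℝ ψ y) y := fun y hy =>
    ((hψ.contDiffAt (Metric.isOpen_ball.mem_nhds hy)).differentiableAt (by simp)).hasFDerivAt
  have hd2 : ∀ y ∈ Metric.ball x (4 * r),
      HasFDerivAt (fderiv ℝ ψ) (fderiv ℝ (fderiv ℝ ψ) y) y := fun y hy =>
    (((hψ.contDiffAt (Metric.isOpen_ball.mem_nhds hy)).fderiv_right (m := 1)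
      (by norm_num)).differentiableAt (by simp)).hasFDerivAt
  have hM0 : 0 ≤ M := (abs_nonneg _).trans (hM x (by simp [hr]))
  have hsub : ∀ y ρ, dist y x + ρ < 4 * r → Metric.closedBall y ρ ⊆ Metric.ball x (4 * r) := by
    intro y ρ h u hu
    rw [Metric.mem_closedBall] at hu
    rw [Metric.mem_ball]
    linarith [dist_triangle u y x]
  have key : ∀ y ∈ Metric.ball x (2 * r), ∀ w v : E, ‖w‖ = 1 → ‖v‖ = 1 →
      |fderiv ℝ (fderiv ℝ ψ) y w v| ≤ 4 * M / r ^ 2 + C := by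
    intro y hy w v hw hv
    rw [Metric.mem_ball] at hy
    have hrw : ‖r • w‖ = r := by rw [norm_smul, hw, mul_one, Real.norm_of_nonneg hr.le]
    have hrv : ‖r • v‖ = r := by rw [norm_smul, hv, mul_one, Real.norm_of_nonneg hr.le]
    have hmem : ∀ u ∈ Metric.closedBall y r, u + r • w ∈ Metric.ball x (4 * r) ∧
        u ∈ Metric.ball x (4 * r) := by
      intro u hu
      have h1 : dist (u + r • w) u = r := by rw [dist_eq_norm, add_sub_cancel_left, hrw]
      rw [Metric.mem_closedBall] at hu
      rw [Metric.mem_ball, Metric.mem_ball]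
      have h2 := dist_triangle u y x
      have h3 := dist_triangle (u + r • w) u x
      constructor <;> linarith
    have hyv : y + r • v ∈ Metric.closedBall y r := by
      rw [Metric.mem_closedBall, dist_eq_norm, add_sub_cancel_left, hrv]
    have hyy : y ∈ Metric.closedBall y r := Metric.mem_closedBall_self hr.le
    obtain ⟨ξ, hξ, h1⟩ := domain_mvt (f := fun u => ψ (u + r • w) - ψ u)
      (f' := fun u => fderiv ℝ ψ (u + r • w) - fderiv ℝ ψ u) (s := Metric.closedBall y r)
      (x := y) (y := y + r • v) (fun u hu => by
        have h := (hd1 _ (hmem u hu).1).comp u ((hasFDerivAt_id u).add_const (r • w))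
        exact (h.sub (hd1 u (hmem u hu).2)).hasFDerivWithinAt)
      (convex_closedBall y r) hyy hyv
    have hξ' : ξ ∈ Metric.closedBall y r := (convex_closedBall y r).segment_subset hyy hyv hξ
    obtain ⟨η, hη, h2⟩ := domain_mvt (f := fun u => fderiv ℝ ψ u (r • v))
      (f' := fun u => (fderiv ℝ (fderiv ℝ ψ) u).flip (r • v)) (s := Metric.ball x (4 * r))
      (x := ξ) (y := ξ + r • w) (fun u hu => by
        have h := (hd2 u hu).clm_apply (hasFDerivAt_const (r • v) u)
        simpa using h.hasFDerivWithinAt)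
      (convex_ball x _) (hmem ξ hξ').2 (hmem ξ hξ').1
    have hη' : η ∈ Metric.ball x (4 * r) :=
      (convex_ball x _).segment_subset (hmem ξ hξ').2 (hmem ξ hξ').1 hη
    have h3 : |fderiv ℝ (fderiv ℝ ψ) η (r • w) (r • v)| ≤ 4 * M := by
      have h4 : fderiv ℝ (fderiv ℝ ψ) η (r • w) (r • v) =
          ψ (y + r • v + r • w) - ψ (y + r • v) - (ψ (y + r • w) - ψ y) := by
        simp only [add_sub_cancel_left, _root_.sub_apply,
          ContinuousLinearMap.flip_apply] at h1 h2
        rw [h1, h2]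
      rw [h4]
      have a1 := abs_le.1 (hM _ (hmem _ hyv).1)
      have a2 := abs_le.1 (hM _ (hmem _ hyv).2)
      have a3 := abs_le.1 (hM _ (hmem _ hyy).1)
      have a4 := abs_le.1 (hM _ (hmem _ hyy).2)
      rw [abs_le]
      constructor <;> linarith [a1.1, a1.2, a2.1, a2.2, a3.1, a3.2, a4.1, a4.2]
    have h5 : |fderiv ℝ (fderiv ℝ ψ) η w v| ≤ 4 * M / r ^ 2 := by
      rw [le_div_iff₀ (by positivity)]
      simp only [map_smul, _root_.smul_apply, smul_eq_mul] at h3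
      rw [abs_mul, abs_mul, abs_of_pos hr] at h3
      linarith
    have h6 := hC y (hmem y hyy).2 η hη' v w
    rw [hw, hv, mul_one, mul_one] at h6
    rw [abs_le] at *
    constructor <;> linarith [h5.1, h5.2, h6.1, h6.2]
  have hK0 : 0 ≤ 4 * M / r ^ 2 + C := by positivity
  have hbd2 : ∀ y ∈ Metric.ball x (2 * r), ‖fderiv ℝ (fderiv ℝ ψ) y‖ ≤ 4 * M / r ^ 2 + C :=
    fun y hy => ContinuousLinearMap.opNorm_le_of_unit_norm hK0 fun w hw =>
      ContinuousLinearMap.opNorm_le_of_unit_norm hK0 fun v hv => key y hy w v hw hv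
  refine ⟨hbd2, fun y hy => ?_⟩
  refine ContinuousLinearMap.opNorm_le_of_unit_norm (by positivity) fun v hv => ?_
  rw [Metric.mem_ball] at hy
  have hrv : ‖r • v‖ = r := by rw [norm_smul, hv, mul_one, Real.norm_of_nonneg hr.le]
  have hyv : y + r • v ∈ Metric.ball x (2 * r) := by
    have h1 : dist (y + r • v) y = r := by rw [dist_eq_norm, add_sub_cancel_left, hrv]
    rw [Metric.mem_ball]
    linarith [dist_triangle (y + r • v) y x]
  have hyy : y ∈ Metric.ball x (2 * r) := by rw [Metric.mem_ball]; linarith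
  have hss : Metric.ball x (2 * r) ⊆ Metric.ball x (4 * r) :=
    Metric.ball_subset_ball (by linarith)
  obtain ⟨ξ, hξ, h1⟩ := domain_mvt (fun u hu => (hd1 u (hss hu)).hasFDerivWithinAt)
    (convex_ball x (2 * r)) hyy hyv
  have hξ' : ξ ∈ Metric.ball x (2 * r) := (convex_ball x _).segment_subset hyy hyv hξ
  have h2 : ‖fderiv ℝ ψ ξ - fderiv ℝ ψ y‖ ≤ (4 * M / r ^ 2 + C) * ‖ξ - y‖ :=
    (convex_ball x (2 * r)).norm_image_sub_le_of_norm_hasFDerivWithin_le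
      (fun u hu => (hd2 u (hss hu)).hasFDerivWithinAt) hbd2 hyy hξ'
  have h3 : ‖ξ - y‖ ≤ r := by
    have := norm_sub_le_of_mem_segment hξ
    rwa [add_sub_cancel_left, hrv] at this
  have h4 : |fderiv ℝ ψ ξ v| ≤ 2 * M / r := by
    rw [le_div_iff₀ hr]
    rw [add_sub_cancel_left, map_smul, smul_eq_mul] at h1
    have a1 := abs_le.1 (hM _ (hss hyv))
    have a2 := abs_le.1 (hM _ (hss hyy))
    have : |r * fderiv ℝ ψ ξ v| ≤ 2 * M := by
      rw [← h1, abs_le]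
      constructor <;> linarith [a1.1, a1.2, a2.1, a2.2]
    rw [abs_mul, abs_of_pos hr] at this
    linarith
  have h5 : |fderiv ℝ ψ ξ v - fderiv ℝ ψ y v| ≤ (4 * M / r ^ 2 + C) * r := by
    have h6 := (fderiv ℝ ψ ξ - fderiv ℝ ψ y).le_opNorm v
    rw [hv, mul_one] at h6
    exact h6.trans (h2.trans (by gcongr))
  rw [Real.norm_eq_abs]
  rw [abs_le] at *
  constructor <;> linarith [h4.1, h4.2, h5.1, h5.2]

/-- A family of `C²` functions on an open set, measurable in the parameter `z ∈ [0,1]`, whose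
derivatives up to order two are bounded locally uniformly in the parameter. -/
structure UniformC2 {n : ℕ} (U : Set (Fin n → ℝ)) (ψ : (Fin n → ℝ) → ℝ → ℝ) : Prop where
  meas : ∀ x ∈ U, Measurable (ψ x)
  smooth : ∀ z ∈ Icc (0:ℝ) 1, ContDiffOn ℝ 2 (fun x => ψ x z) U
  bdd : ∀ x ∈ U, ∃ r > 0, Metric.ball x r ⊆ U ∧ ∃ C, ∀ y ∈ Metric.ball x r, ∀ z ∈ Icc (0:ℝ) 1,
    |ψ y z| ≤ C ∧ ‖fderiv ℝ (fun x => ψ x z) y‖ ≤ C ∧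
      ‖fderiv ℝ (fderiv ℝ (fun x => ψ x z)) y‖ ≤ C

lemma JumpKernel.uniformC2 {n : ℕ} {T : ℝ} (K : JumpKernel n T) {t : ℝ} (ht : t ∈ Icc (0:ℝ) T)
    (i : Fin n) : UniformC2 (posOrth n) (fun x z => K.φ x t z i) := by
  have hsm : ∀ z ∈ Icc (0:ℝ) 1, ContDiffOn ℝ 2 (fun x => K.φ x t z i) (posOrth n) := fun z hz =>
    (contDiff_apply ℝ ℝ i).comp_contDiffOn (K.smooth t ht z hz)
  refine ⟨fun x hx => (measurable_pi_apply i).comp (K.meas x hx t ht), hsm, fun x hx => ?_⟩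
  obtain ⟨α, -, -, h⟩ := K.holder2
  obtain ⟨s, hs, hsU, C, hC⟩ := h t ht x hx
  obtain ⟨D, hD, hbd⟩ := K.bound
  obtain ⟨ρ, hρ, hρs⟩ := Metric.mem_nhds_iff.1 hs
  have hr : 0 < ρ / 4 := by positivity
  have h4 : 4 * (ρ / 4) = ρ := by ring
  have hρU := hρs.trans hsU
  have hM : ∀ z ∈ Icc (0:ℝ) 1, ∀ y ∈ Metric.ball x ρ, |K.φ y t z i| ≤ D * (x i + ρ) ^ 2 + 1 := by
    intro z hz y hy
    have h1 := hbd y (hρU hy) t ht z hz i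
    have h2 : y i ≤ x i + ρ := by
      have h3 := (abs_le.1 ((norm_le_pi_norm (y - x) i).trans
        (mem_ball_iff_norm.1 hy).le)).2
      rw [Pi.sub_apply] at h3
      linarith
    have h3 : (y i) ^ 2 ≤ (x i + ρ) ^ 2 := pow_le_pow_left₀ (hρU hy i).le h2 2
    have h5 : D * (y i) ^ 2 ≤ D * (x i + ρ) ^ 2 := by gcongr
    rw [abs_le]
    constructor <;> nlinarith [sq_nonneg (K.φ y t z i - 1), sq_nonneg (K.φ y t z i + 1)]
  have hbounds := fun z (hz : z ∈ Icc (0:ℝ) 1) =>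
    norm_fderiv_le_of_osc (ψ := fun y => K.φ y t z i) (x := x) (r := ρ / 4)
      (M := D * (x i + ρ) ^ 2 + 1) (C := C * (2 * ρ) ^ (α : ℝ)) hr (by positivity)
      (by rw [h4]; exact (hsm z hz).mono hρU)
      (by rw [h4]; exact hM z hz)
      (by
        rw [h4]
        intro y hy y' hy' v w
        have hproj : ∀ y ∈ Metric.ball x ρ, fderiv ℝ (fderiv ℝ fun y => K.φ y t z i) y w v =
            iteratedFDeriv ℝ 2 (fun y => K.φ y t z) y ![w, v] i := by
          intro y hy
          have h1 := (ContinuousLinearMap.proj (R := ℝ) (φ := fun _ : Fin n => ℝ)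
            i).iteratedFDeriv_comp_left (((K.smooth t ht z hz).contDiffAt
              ((isOpen_posOrth n).mem_nhds (hρU hy)))) (i := 2) le_rfl
          have h2 := congrArg (fun A => A ![w, v]) h1
          simpa [iteratedFDeriv_two_apply, Function.comp_def] using h2
        rw [hproj y hy, hproj y' hy']
        have h1 := (hC z hz).dist_le (hρs hy) (hρs hy')
        rw [dist_eq_norm] at h1
        have h2 : dist y y' ≤ 2 * ρ := by
          have := dist_triangle_right y y' x
          rw [Metric.mem_ball] at hy hy'
          linarith
        have h3 : (dist y y') ^ (α : ℝ) ≤ (2 * ρ) ^ (α : ℝ) :=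
          Real.rpow_le_rpow dist_nonneg h2 α.2
        have h5 := (iteratedFDeriv ℝ 2 (fun y => K.φ y t z) y -
          iteratedFDeriv ℝ 2 (fun y => K.φ y t z) y').le_opNorm ![w, v]
        simp only [_root_.sub_apply, Fin.prod_univ_two, Matrix.cons_val_zero,
          Matrix.cons_val_one] at h5
        have h6 := (norm_le_pi_norm _ i).trans h5
        rw [Pi.sub_apply, Real.norm_eq_abs] at h6
        refine h6.trans ?_
        rw [← mul_assoc]
        gcongr
        exact h1.trans (by gcongr))
  set M := D * (x i + ρ) ^ 2 + 1
  set A := C * (2 * ρ) ^ (α : ℝ)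
  refine ⟨ρ / 4, hr, (Metric.ball_subset_ball (by linarith)).trans hρU,
    max M (max (4 * M / (ρ / 4) ^ 2 + A) (2 * M / (ρ / 4) + (4 * M / (ρ / 4) ^ 2 + A) * (ρ / 4))),
    fun y hy z hz => ⟨?_, ?_, ?_⟩⟩
  · exact (hM z hz y (Metric.ball_subset_ball (by linarith) hy)).trans (le_max_left _ _)
  · exact ((hbounds z hz).2 y hy).trans ((le_max_right _ _).trans (le_max_right _ _))
  · exact ((hbounds z hz).1 y (Metric.ball_subset_ball (by linarith) hy)).trans
      ((le_max_left _ _).trans (le_max_right _ _))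

lemma aestronglyMeasurable_of_hasFDerivAt {α E : Type*} [MeasurableSpace α] {μ : Measure α}
    [NormedAddCommGroup E] [NormedSpace ℝ E] {U : Set E} {f : E → α → ℝ} {f' : α → E →L[ℝ] ℝ}
    {x : E} (hU : U ∈ nhds x) (hf : ∀ y ∈ U, AEStronglyMeasurable (f y) μ)
    (hd : ∀ᵐ z ∂μ, HasFDerivAt (fun y => f y z) (f' z) x) (v : E) :
    AEStronglyMeasurable (fun z => f' z v) μ := by
  have hc : Filter.Tendsto (fun k : ℕ => x + (1 / ((k : ℝ) + 1)) • v) Filter.atTop (nhds x) := by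
    have := (tendsto_one_div_add_atTop_nhds_zero_nat (𝕜 := ℝ)).smul_const v
    simpa using this.const_add x
  obtain ⟨N, hN⟩ := Filter.eventually_atTop.1 (hc.eventually hU)
  have hx := hf x (mem_of_mem_nhds hU)
  refine aestronglyMeasurable_of_tendsto_ae Filter.atTop
    (f := fun (k : ℕ) z => (((k + N : ℕ) : ℝ) + 1) *
      (f (x + (1 / (((k + N : ℕ) : ℝ) + 1)) • v) z - f x z))
    (fun k => ((hf _ (hN _ (Nat.le_add_left N k))).sub hx).const_mul _) ?_
  filter_upwards [hd] with z hz
  have h1 := hz.lim_real v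
  have h2 := (h1.comp (Filter.tendsto_atTop_add_const_right _ (1:ℝ)
    tendsto_natCast_atTop_atTop)).comp (Filter.tendsto_add_atTop_nat N)
  refine h2.congr fun k => ?_
  simp [Function.comp_def]

lemma aestronglyMeasurable_clm {α : Type*} [MeasurableSpace α] {μ : Measure α} {n : ℕ}
    {L : α → (Fin n → ℝ) →L[ℝ] ℝ} (h : ∀ v, AEStronglyMeasurable (fun z => L z v) μ) :
    AEStronglyMeasurable L μ := by
  have : L = fun z => ∑ j, (L z (Pi.single j 1)) •
      (ContinuousLinearMap.proj (R := ℝ) (φ := fun _ : Fin n => ℝ) j) := by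
    funext z
    ext v
    conv_lhs => rw [pi_eq_sum_univ' v]
    simp [mul_comm]
  rw [this]
  exact Finset.aestronglyMeasurable_fun_sum _ fun j _ => (h _).smul_const _

/-- Differentiation under the integral sign for a `C¹` function of a uniformly differentiable
family. -/
lemma hasFDerivAt_integral_comp {α : Type*} [MeasurableSpace α] {μ : Measure α}
    [IsFiniteMeasure μ] {n : ℕ} {G : Type*} [NormedAddCommGroup G] [NormedSpace ℝ G]
    [ProperSpace G] {Θ : G → ℝ} (hΘ : ContDiff ℝ 1 Θ) {J : (Fin n → ℝ) → α → G}
    {J' : (Fin n → ℝ) → α → (Fin n → ℝ) →L[ℝ] G} {x : Fin n → ℝ} {r C : ℝ} (hr : 0 < r)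
    (hm : ∀ y ∈ Metric.ball x r, AEStronglyMeasurable (J y) μ)
    (hd : ∀ᵐ z ∂μ, ∀ y ∈ Metric.ball x r,
      HasFDerivAt (fun y => J y z) (J' y z) y ∧ ‖J y z‖ ≤ C ∧ ‖J' y z‖ ≤ C) :
    Integrable (fun z => Θ (J x z)) μ ∧
    ∃ L : (Fin n → ℝ) →L[ℝ] ℝ, HasFDerivAt (fun y => ∫ z, Θ (J y z) ∂μ) L x ∧
      ∀ v, Integrable (fun z => fderiv ℝ Θ (J x z) (J' x z v)) μ ∧
        L v = ∫ z, fderiv ℝ Θ (J x z) (J' x z v) ∂μ := by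
  have hx : x ∈ Metric.ball x r := Metric.mem_ball_self hr
  obtain ⟨A, hA⟩ := (isCompact_closedBall (0:G) C).exists_bound_of_continuousOn
    hΘ.continuous.continuousOn
  obtain ⟨B, hB⟩ := (isCompact_closedBall (0:G) C).exists_bound_of_continuousOn
    (hΘ.continuous_fderiv (by simp)).continuousOn
  have hmΘ : ∀ y ∈ Metric.ball x r, AEStronglyMeasurable (fun z => Θ (J y z)) μ := fun y hy =>
    hΘ.continuous.comp_aestronglyMeasurable (hm y hy)
  have hint : Integrable (fun z => Θ (J x z)) μ := by
    refine Integrable.of_bound (hmΘ x hx) A ?_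
    filter_upwards [hd] with z hz
    exact hA _ (by simpa using (hz x hx).2.1)
  have hd' : ∀ᵐ z ∂μ, ∀ y ∈ Metric.ball x r,
      HasFDerivAt (fun y => Θ (J y z)) ((fderiv ℝ Θ (J y z)).comp (J' y z)) y := by
    filter_upwards [hd] with z hz y hy
    exact ((hΘ.differentiable (by simp)) (J y z)).hasFDerivAt.comp y (hz y hy).1
  have hbd : ∀ᵐ z ∂μ, ∀ y ∈ Metric.ball x r, ‖(fderiv ℝ Θ (J y z)).comp (J' y z)‖ ≤ B * C := by
    filter_upwards [hd] with z hz y hy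
    have h1 := hB (J y z) (by simpa using (hz y hy).2.1)
    exact (ContinuousLinearMap.opNorm_comp_le _ _).trans
      (mul_le_mul h1 (hz y hy).2.2 (norm_nonneg _) ((norm_nonneg _).trans h1))
  have hm' : AEStronglyMeasurable (fun z => (fderiv ℝ Θ (J x z)).comp (J' x z)) μ :=
    aestronglyMeasurable_clm fun v => aestronglyMeasurable_of_hasFDerivAt
      (Metric.ball_mem_nhds x hr) hmΘ (by filter_upwards [hd'] with z hz using hz x hx) v
  have hint' : Integrable (fun z => (fderiv ℝ Θ (J x z)).comp (J' x z)) μ :=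
    Integrable.of_bound hm' (B * C) (by filter_upwards [hbd] with z hz using hz x hx)
  refine ⟨hint, _, hasFDerivAt_integral_of_dominated_of_fderiv_le (bound := fun _ => B * C)
    (Metric.ball_mem_nhds x hr)
    (Filter.eventually_of_mem (Metric.ball_mem_nhds x hr) hmΘ) hint hm' hbd
    (integrable_const _) hd', fun v => ⟨?_, ?_⟩⟩
  · exact hint'.apply_continuousLinearMap v
  · exact ContinuousLinearMap.integral_apply hint' v

/-- The `i`-th coordinate of the point together with the value and the `i`-th partial derivative
of a family of functions. -/
def jet {n : ℕ} (i : Fin n) (ψ : (Fin n → ℝ) → ℝ → ℝ) (y : Fin n → ℝ) (z : ℝ) : ℝ × ℝ × ℝ :=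
  (y i, ψ y z, fderiv ℝ (fun x => ψ x z) y (Pi.single i 1))

lemma UniformC2.hasFDerivAt_integral_jet {n : ℕ} {U : Set (Fin n → ℝ)} (hU : IsOpen U)
    {ψ : (Fin n → ℝ) → ℝ → ℝ} (h : UniformC2 U ψ) (i : Fin n) {Θ : ℝ × ℝ × ℝ → ℝ}
    (hΘ : ContDiff ℝ 1 Θ) {x : Fin n → ℝ} (hx : x ∈ U) :
    Integrable (fun z => Θ (jet i ψ x z)) (volume.restrict (Icc (0:ℝ) 1)) ∧
    ∃ L : (Fin n → ℝ) →L[ℝ] ℝ,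
      HasFDerivAt (fun y => ∫ z in Icc (0:ℝ) 1, Θ (jet i ψ y z)) L x ∧
      Integrable (fun z => fderiv ℝ Θ (jet i ψ x z)
        (1, fderiv ℝ (fun x => ψ x z) x (Pi.single i 1),
          dir2 (fun x => ψ x z) x (Pi.single i 1))) (volume.restrict (Icc (0:ℝ) 1)) ∧
      L (Pi.single i 1) = ∫ z in Icc (0:ℝ) 1, fderiv ℝ Θ (jet i ψ x z)
        (1, fderiv ℝ (fun x => ψ x z) x (Pi.single i 1),
          dir2 (fun x => ψ x z) x (Pi.single i 1)) := by
  set e : Fin n → ℝ := Pi.single i 1 with he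
  obtain ⟨r, hr, hrU, C, hC⟩ := h.bdd x hx
  have hZ : ∀ᵐ z ∂(volume.restrict (Icc (0:ℝ) 1)), z ∈ Icc (0:ℝ) 1 :=
    ae_restrict_mem measurableSet_Icc
  have hd1 : ∀ z ∈ Icc (0:ℝ) 1, ∀ y ∈ U,
      HasFDerivAt (fun x => ψ x z) (fderiv ℝ (fun x => ψ x z) y) y := fun z hz y hy =>
    (((h.smooth z hz).contDiffAt (hU.mem_nhds hy)).differentiableAt (by simp)).hasFDerivAt
  have hd2 : ∀ z ∈ Icc (0:ℝ) 1, ∀ y ∈ U,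
      HasFDerivAt (fun y => fderiv ℝ (fun x => ψ x z) y e)
        ((fderiv ℝ (fderiv ℝ (fun x => ψ x z)) y).flip e) y := fun z hz y hy => by
    have h1 := ((((h.smooth z hz).contDiffAt (hU.mem_nhds hy)).fderiv_right (m := 1)
      (by norm_num)).differentiableAt (by simp)).hasFDerivAt
    simpa using h1.clm_apply (hasFDerivAt_const e y)
  set J' : (Fin n → ℝ) → ℝ → (Fin n → ℝ) →L[ℝ] ℝ × ℝ × ℝ := fun y z =>
    (ContinuousLinearMap.proj (R := ℝ) (φ := fun _ : Fin n => ℝ) i).prod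
      ((fderiv ℝ (fun x => ψ x z) y).prod ((fderiv ℝ (fderiv ℝ (fun x => ψ x z)) y).flip e))
    with hJ'
  have hm : ∀ y ∈ Metric.ball x r,
      AEStronglyMeasurable (jet i ψ y) (volume.restrict (Icc (0:ℝ) 1)) := by
    intro y hy
    have h3 := aestronglyMeasurable_of_hasFDerivAt (hU.mem_nhds (hrU hy))
      (fun y hy => (h.meas y hy).aestronglyMeasurable)
      (by filter_upwards [hZ] with z hz using hd1 z hz y (hrU hy)) e
    exact aestronglyMeasurable_const.prodMk
      ((h.meas y (hrU hy)).aestronglyMeasurable.prodMk h3)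
  have hbe : ‖e‖ ≤ 1 := by
    rw [pi_norm_le_iff_of_nonneg zero_le_one]
    intro j
    rw [he, Pi.single_apply]
    split_ifs <;> simp
  have hd : ∀ᵐ z ∂(volume.restrict (Icc (0:ℝ) 1)), ∀ y ∈ Metric.ball x r,
      HasFDerivAt (fun y => jet i ψ y z) (J' y z) y ∧
        ‖jet i ψ y z‖ ≤ max (max (‖x‖ + r) C) 1 ∧ ‖J' y z‖ ≤ max (max (‖x‖ + r) C) 1 := by
    filter_upwards [hZ] with z hz y hy
    obtain ⟨b0, b1, b2⟩ := hC y hy z hz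
    have hC1 : C ≤ max (max (‖x‖ + r) C) 1 := (le_max_right _ _).trans (le_max_left _ _)
    refine ⟨?_, ?_, ?_⟩
    · exact (hasFDerivAt_apply i y).prodMk
        ((hd1 z hz y (hrU hy)).prodMk (hd2 z hz y (hrU hy)))
    · refine norm_prod_le_iff.2 ⟨?_, norm_prod_le_iff.2 ⟨b0.trans hC1, ?_⟩⟩
      · refine ((norm_le_pi_norm y i).trans ?_).trans ((le_max_left _ _).trans (le_max_left _ _))
        have h1 := norm_le_norm_add_norm_sub' y x
        have h2 := mem_ball_iff_norm.1 hy
        linarith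
      · refine ((ContinuousLinearMap.le_opNorm _ _).trans ?_).trans hC1
        exact (mul_le_of_le_one_right (norm_nonneg _) hbe).trans b1
    · refine (ContinuousLinearMap.opNorm_prod _ _).le.trans
        (norm_prod_le_iff.2 ⟨?_, (ContinuousLinearMap.opNorm_prod _ _).le.trans
          (norm_prod_le_iff.2 ⟨b1.trans hC1, ?_⟩)⟩)
      · refine le_trans (ContinuousLinearMap.opNorm_le_bound _ zero_le_one fun y => ?_)
          (le_max_right _ _)
        rw [one_mul]
        exact norm_le_pi_norm y i
      · have h1 := (fderiv ℝ (fderiv ℝ (fun x => ψ x z)) y).flip.le_opNorm e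
        rw [ContinuousLinearMap.opNorm_flip] at h1
        exact ((h1.trans (mul_le_of_le_one_right (ContinuousLinearMap.opNorm_nonneg _) hbe)).trans
          b2).trans hC1
  obtain ⟨hint, L, hL, hLv⟩ := hasFDerivAt_integral_comp hΘ hr hm hd
  have heq : (fun z => fderiv ℝ Θ (jet i ψ x z) (J' x z e)) =ᵐ[volume.restrict (Icc (0:ℝ) 1)]
      fun z => fderiv ℝ Θ (jet i ψ x z)
        (1, fderiv ℝ (fun x => ψ x z) x e, dir2 (fun x => ψ x z) x e) := by
    filter_upwards [hZ] with z hz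
    have h1 : dir2 (fun x => ψ x z) x e = fderiv ℝ (fderiv ℝ (fun x => ψ x z)) x e e := by
      rw [dir2, dmix, (hd2 z hz x hx).fderiv, ContinuousLinearMap.flip_apply]
    rw [h1]
    simp [hJ', he]
  exact ⟨hint, L, hL, (hLv e).1.congr heq, (hLv e).2.trans (integral_congr_ae heq)⟩

lemma UniformC2.dir2_integral_jet {n : ℕ} {U : Set (Fin n → ℝ)} (hU : IsOpen U)
    {ψ : (Fin n → ℝ) → ℝ → ℝ} (h : UniformC2 U ψ) (i : Fin n) {Θ₀ Θ₁ : ℝ × ℝ × ℝ → ℝ}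
    (hΘ₀ : ContDiff ℝ 1 Θ₀) (hΘ₁ : ContDiff ℝ 1 Θ₁)
    (h01 : ∀ p c, fderiv ℝ Θ₀ p (1, p.2.2, c) = Θ₁ p) {x : Fin n → ℝ} (hx : x ∈ U) :
    dir2 (fun y => ∫ z in Icc (0:ℝ) 1, Θ₀ (jet i ψ y z)) x (Pi.single i 1) =
      ∫ z in Icc (0:ℝ) 1, fderiv ℝ Θ₁ (jet i ψ x z)
        (1, fderiv ℝ (fun x => ψ x z) x (Pi.single i 1),
          dir2 (fun x => ψ x z) x (Pi.single i 1)) := by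
  have h1 : (fun y => fderiv ℝ (fun y => ∫ z in Icc (0:ℝ) 1, Θ₀ (jet i ψ y z)) y
      (Pi.single i 1)) =ᶠ[nhds x] fun y => ∫ z in Icc (0:ℝ) 1, Θ₁ (jet i ψ y z) := by
    filter_upwards [hU.mem_nhds hx] with y hy
    obtain ⟨-, L, hL, -, hLe⟩ := h.hasFDerivAt_integral_jet hU i hΘ₀ hy
    rw [hL.fderiv, hLe]
    congr 1
    funext z
    exact h01 (jet i ψ y z) _
  obtain ⟨-, L, hL, -, hLe⟩ := h.hasFDerivAt_integral_jet hU i hΘ₁ hx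
  rw [dir2, dmix, h1.fderiv_eq, hL.fderiv, hLe]

/-- If `w ↦ w² G(1 / w)` is convex and `G` grows at most quadratically, then `G(s) / s²` is
nondecreasing. -/
lemma monotoneOn_div_sq {G G₁ G₂ : ℝ → ℝ} {D : ℝ} (h1 : ∀ s, 0 < s → HasDerivAt G (G₁ s) s)
    (h2 : ∀ s, 0 < s → HasDerivAt G₁ (G₂ s) s)
    (hnn : ∀ s, 0 < s → 0 ≤ s ^ 2 * G₂ s - 2 * s * G₁ s + 2 * G s)
    (hD : ∀ s, 0 < s → G s ≤ D * s ^ 2) : MonotoneOn (fun s => G s / s ^ 2) (Ioi 0) := by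
  set k : ℝ → ℝ := fun s => G₁ s - 2 * G s / s with hk
  have hk' : ∀ s, 0 < s → HasDerivAt k ((s ^ 2 * G₂ s - 2 * s * G₁ s + 2 * G s) / s ^ 2) s := by
    intro s hs
    refine ((h2 s hs).sub (((h1 s hs).const_mul 2).div (hasDerivAt_id s) hs.ne')).congr_deriv ?_
    simp only [id]
    field_simp
    ring
  have hg' : ∀ s, 0 < s → HasDerivAt (fun s => G s / s ^ 2) (k s / s ^ 2) s := by
    intro s hs
    refine ((h1 s hs).div (hasDerivAt_pow 2 s) (by positivity)).congr_deriv ?_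
    simp only [hk]
    field_simp
    ring
  have hkmono : MonotoneOn k (Ioi 0) := by
    refine monotoneOn_of_deriv_nonneg (convex_Ioi 0)
      (fun s hs => (hk' s hs).continuousAt.continuousWithinAt) ?_ ?_
    · rw [interior_Ioi]
      exact fun s hs => (hk' s hs).differentiableAt.differentiableWithinAt
    · rw [interior_Ioi]
      intro s hs
      rw [(hk' s hs).deriv]
      exact div_nonneg (hnn s hs) (sq_nonneg s)
  have hknn : ∀ s, 0 < s → 0 ≤ k s := by
    intro s₀ hs₀
    by_contra! hneg
    have hanti : AntitoneOn (fun s => G s / s ^ 2 + k s₀ / s) (Ioc 0 s₀) := by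
      have hd : ∀ s, 0 < s →
          HasDerivAt (fun s => G s / s ^ 2 + k s₀ / s) ((k s - k s₀) / s ^ 2) s := by
        intro s hs
        refine ((hg' s hs).add
          ((hasDerivAt_const s (k s₀)).div (hasDerivAt_id s) hs.ne')).congr_deriv ?_
        simp only [id]
        field_simp
        ring
      refine antitoneOn_of_deriv_nonpos (convex_Ioc 0 s₀)
        (fun s hs => (hd s hs.1).continuousAt.continuousWithinAt) ?_ ?_
      · rw [interior_Ioc]
        exact fun s hs => (hd s hs.1).differentiableAt.differentiableWithinAt
      · rw [interior_Ioc]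
        intro s hs
        rw [(hd s hs.1).deriv]
        exact div_nonpos_of_nonpos_of_nonneg (sub_nonpos.2 (hkmono hs.1 hs₀ hs.2.le)) (sq_nonneg s)
    set B := G s₀ / s₀ ^ 2 + k s₀ / s₀ with hB
    set R := max (1 / s₀) ((|D| + |B| + 1) / (-k s₀)) with hR
    have hR0 : 0 < R := lt_of_lt_of_le (by positivity) (le_max_left _ _)
    have hs : 0 < 1 / R := by positivity
    have hss : 1 / R ≤ s₀ := by
      rw [one_div_le hR0 hs₀]
      exact le_max_left _ _
    have h3 := hanti ⟨hs, hss⟩ ⟨hs₀, le_rfl⟩ hss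
    have h4 : G (1 / R) / (1 / R) ^ 2 ≤ D := by
      rw [div_le_iff₀ (by positivity)]
      exact hD _ hs
    have h5 : |D| + |B| + 1 ≤ R * (-k s₀) := by
      rw [← div_le_iff₀ (by linarith)]
      exact le_max_right _ _
    have h6 : k s₀ / (1 / R) = R * k s₀ := by field_simp
    simp only [h6] at h3
    linarith [le_abs_self D, neg_abs_le B]
  refine monotoneOn_of_deriv_nonneg (convex_Ioi 0)
    (fun s hs => (hg' s hs).continuousAt.continuousWithinAt) ?_ ?_
  · rw [interior_Ioi]
    exact fun s hs => (hg' s hs).differentiableAt.differentiableWithinAt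
  · rw [interior_Ioi]
    intro s hs
    rw [(hg' s hs).deriv]
    exact div_nonneg (hknn s hs) (sq_nonneg s)

lemma fderiv_apply_eq_of_hasDerivAt {E : Type*} [NormedAddCommGroup E] [NormedSpace ℝ E]
    {Θ : E → ℝ} {p v : E} {d : ℝ} (hΘ : DifferentiableAt ℝ Θ p)
    (h : HasDerivAt (fun s : ℝ => Θ (p + s • v)) d 0) : fderiv ℝ Θ p v = d :=
  (hΘ.hasFDerivAt.hasLineDerivAt v).unique h

lemma hasDerivAt_comp_of_eq {F u : ℝ → ℝ} {u' a s : ℝ} (hF : Differentiable ℝ F)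
    (hu : HasDerivAt u u' s) (ha : u s = a) :
    HasDerivAt (fun s => F (u s)) (deriv F a * u') s := by
  subst ha
  exact (hF (u s)).hasDerivAt.comp s hu

lemma hasDerivAt_affine (a b : ℝ) : HasDerivAt (fun s : ℝ => a + s * b) b 0 := by
  simpa using ((hasDerivAt_id' (0:ℝ)).mul_const b).const_add a

lemma fderiv_comp_apply {n : ℕ} (i : Fin n) {F : ℝ → ℝ} (hF : Differentiable ℝ F)
    (y v : Fin n → ℝ) : fderiv ℝ (fun y => F (y i)) y v = deriv F (y i) * v i := by
  have hi : HasFDerivAt (fun y : Fin n → ℝ => y i)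
      (ContinuousLinearMap.proj (R := ℝ) (φ := fun _ : Fin n => ℝ) i) y := hasFDerivAt_apply i y
  have h : HasFDerivAt (fun y : Fin n → ℝ => F (y i)) _ y :=
    HasDerivAt.comp_hasFDerivAt (f := fun y : Fin n → ℝ => y i) y (hF (y i)).hasDerivAt hi
  rw [h.fderiv]
  simp

open scoped ContDiff in
/-- Testing the LCP property against functions of a single coordinate. -/
lemma integral_mul_dir2_nonneg {n : ℕ} {T : ℝ} (K : JumpKernel n T) {lam : ℝ → ℝ}
    {x : Fin n → ℝ} (hx : x ∈ posOrth n) {t : ℝ} (ht : t ∈ Icc (0:ℝ) T) (hlam : 0 < lam t)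
    (hfin : ((fun z => K.φ x t z) '' Icc (0:ℝ) 1).Finite)
    (hLCP : IsLCPAt (Bop lam K) x t) (i : Fin n) :
    0 ≤ ∫ z in Icc (0:ℝ) 1,
      K.φ x t z i * dir2 (fun y => K.φ y t z i) x (Pi.single i 1) := by
  classical
  set ψ : (Fin n → ℝ) → ℝ → ℝ := fun y z => K.φ y t z i with hψ
  obtain ⟨F, hF, hmono, hC, hS⟩ := exists_smooth_convex_interp
    (insert (x i) (hfin.toFinset.image fun v => x i + v i))
  have hFx := hS (x i) (by simp)
  have hFz : ∀ z ∈ Icc (0:ℝ) 1,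
      deriv F (x i + ψ x z) = x i + ψ x z ∧ deriv (deriv F) (x i + ψ x z) = 0 := by
    intro z hz
    refine hS _ (Finset.mem_insert_of_mem (Finset.mem_image.2 ⟨K.φ x t z, ?_, rfl⟩))
    exact hfin.mem_toFinset.2 ⟨z, hz, rfl⟩
  have hF1 : ContDiff ℝ ∞ (deriv F) := (contDiff_infty_iff_deriv.1 hF).2
  have hF2 : ContDiff ℝ ∞ (deriv (deriv F)) := (contDiff_infty_iff_deriv.1 hF1).2
  have hd0 : Differentiable ℝ F := hF.differentiable (by simp)
  have hd1 : Differentiable ℝ (deriv F) := hF1.differentiable (by simp)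
  have hd2 : Differentiable ℝ (deriv (deriv F)) := hF2.differentiable (by simp)
  have hF3 : deriv (deriv (deriv F)) (x i) = 0 :=
    IsLocalMin.deriv_eq_zero (Filter.Eventually.of_forall fun u => by
      rw [hFx.2]; exact hmono.deriv_nonneg)
  have hdir : dir2 (fun y => F (y i)) x (Pi.single i 1) = 0 := by
    have h1 : (fun y => fderiv ℝ (fun y : Fin n → ℝ => F (y i)) y (Pi.single i 1)) =
        fun y => deriv F (y i) := by
      funext y
      simp [fderiv_comp_apply i hd0]
    rw [dir2, dmix, h1, fderiv_comp_apply i hd1, hFx.2, zero_mul]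
  have hpos := hLCP (Pi.single i 1) (by simp) _ (memTestClass_comp_apply i hF hC)
    (convexOn_comp_apply i hF hmono) hdir
  set Θ₀ : ℝ × ℝ × ℝ → ℝ := fun p =>
    lam t * (F (p.1 + p.2.1) - F p.1 - deriv F p.1 * p.2.1) with hΘ₀
  set Θ₁ : ℝ × ℝ × ℝ → ℝ := fun p =>
    lam t * (deriv F (p.1 + p.2.1) * (1 + p.2.2) - deriv F p.1 -
      (deriv (deriv F) p.1 * p.2.1 + deriv F p.1 * p.2.2)) with hΘ₁
  have hF0' : ContDiff ℝ 1 F := contDiff_infty.1 hF 1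
  have hF1' : ContDiff ℝ 1 (deriv F) := contDiff_infty.1 hF1 1
  have hF2' : ContDiff ℝ 1 (deriv (deriv F)) := contDiff_infty.1 hF2 1
  have hΘ₀s : ContDiff ℝ 1 Θ₀ := by fun_prop
  have hΘ₁s : ContDiff ℝ 1 Θ₁ := by fun_prop
  have hB : (fun y => Bop lam K (fun y => F (y i)) y t) =
      fun y => ∫ z in Icc (0:ℝ) 1, Θ₀ (jet i ψ y z) := by
    funext y
    rw [Bop, ← integral_const_mul]
    congr 1
    funext z
    rw [fderiv_comp_apply i hd0]
    rfl
  have h01 : ∀ p c, fderiv ℝ Θ₀ p (1, p.2.2, c) = Θ₁ p := by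
    rintro ⟨a, b, c⟩ d
    refine fderiv_apply_eq_of_hasDerivAt (hΘ₀s.differentiable (by simp) _) ?_
    have ha := hasDerivAt_affine a 1
    have hb := hasDerivAt_affine b c
    have h := (((hasDerivAt_comp_of_eq (a := a + b) hd0 (ha.add hb) (by simp)).sub
      (hasDerivAt_comp_of_eq (a := a) hd0 ha (by simp))).sub
      ((hasDerivAt_comp_of_eq (a := a) hd1 ha (by simp)).mul hb)).const_mul (lam t)
    refine h.congr_deriv ?_
    simp [hΘ₁]
  have h12 : ∀ a b c d, fderiv ℝ Θ₁ (a, b, c) (1, c, d) =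
      lam t * (deriv (deriv F) (a + b) * (1 + c) * (1 + c) + deriv F (a + b) * d -
        deriv (deriv F) a - (deriv (deriv (deriv F)) a * b + deriv (deriv F) a * c +
          (deriv (deriv F) a * c + deriv F a * d))) := by
    intro a b c d
    refine fderiv_apply_eq_of_hasDerivAt (hΘ₁s.differentiable (by simp) _) ?_
    have ha := hasDerivAt_affine a 1
    have hb := hasDerivAt_affine b c
    have hc := hasDerivAt_affine c d
    have h := ((((hasDerivAt_comp_of_eq (a := a + b) hd1 (ha.add hb) (by simp)).mul
      (hc.const_add 1)).sub (hasDerivAt_comp_of_eq (a := a) hd1 ha (by simp))).sub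
      (((hasDerivAt_comp_of_eq (a := a) hd2 ha (by simp)).mul hb).add
        ((hasDerivAt_comp_of_eq (a := a) hd1 ha (by simp)).mul hc))).const_mul (lam t)
    refine h.congr_deriv ?_
    simp
  rw [hB, (K.uniformC2 ht i).dir2_integral_jet (isOpen_posOrth n) i hΘ₀s hΘ₁s h01 hx] at hpos
  have hint : ∫ z in Icc (0:ℝ) 1, fderiv ℝ Θ₁ (jet i ψ x z)
        (1, fderiv ℝ (fun x => ψ x z) x (Pi.single i 1),
          dir2 (fun x => ψ x z) x (Pi.single i 1)) =
      ∫ z in Icc (0:ℝ) 1, lam t * (ψ x z * dir2 (fun y => ψ y z) x (Pi.single i 1)) := by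
    refine setIntegral_congr_fun measurableSet_Icc fun z hz => ?_
    simp only [jet]
    rw [h12, (hFz z hz).1, (hFz z hz).2, hFx.1, hFx.2, hF3]
    ring
  rw [hint, integral_const_mul] at hpos
  exact nonneg_of_mul_nonneg_right hpos hlam

/-- Monotonicity of the relative second moment along a coordinate direction. -/
lemma UniformC2.monotoneOn_integral_sq_div_sq {n : ℕ} {ψ : (Fin n → ℝ) → ℝ → ℝ}
    (h : UniformC2 (posOrth n) ψ) (i : Fin n) {D : ℝ}
    (hD : ∀ x ∈ posOrth n, ∀ z ∈ Icc (0:ℝ) 1, (ψ x z) ^ 2 ≤ D * (x i) ^ 2)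
    (hnn : ∀ x ∈ posOrth n,
      0 ≤ ∫ z in Icc (0:ℝ) 1, ψ x z * dir2 (fun y => ψ y z) x (Pi.single i 1))
    {x : Fin n → ℝ} (hx : x ∈ posOrth n) :
    MonotoneOn (fun s => (∫ z in Icc (0:ℝ) 1, (ψ (Function.update x i s) z) ^ 2) / s ^ 2)
      (Ioi 0) := by
  set γ : ℝ → Fin n → ℝ := Function.update x i with hγ
  set e : Fin n → ℝ := Pi.single i 1 with he
  have hγs : ∀ s, 0 < s → γ s ∈ posOrth n := by
    intro s hs k
    rcases eq_or_ne k i with rfl | hk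
    · simpa [hγ] using hs
    · simpa [hγ, hk] using hx k
  have hγd : ∀ s, HasDerivAt γ e s := fun s => hasDerivAt_update x i s
  set Θ₀ : ℝ × ℝ × ℝ → ℝ := fun p => p.2.1 * p.2.1 with hΘ₀
  set Θ₁ : ℝ × ℝ × ℝ → ℝ := fun p => 2 * (p.2.1 * p.2.2) with hΘ₁
  set Θ₂ : ℝ × ℝ × ℝ → ℝ := fun p => p.2.2 * p.2.2 with hΘ₂
  have hΘ₀s : ContDiff ℝ 1 Θ₀ := by fun_prop
  have hΘ₁s : ContDiff ℝ 1 Θ₁ := by fun_prop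
  have hΘ₂s : ContDiff ℝ 1 Θ₂ := by fun_prop
  have h0 : ∀ a b c d, fderiv ℝ Θ₀ (a, b, c) (1, c, d) = 2 * (b * c) := by
    intro a b c d
    refine fderiv_apply_eq_of_hasDerivAt (hΘ₀s.differentiable (by simp) _) ?_
    refine ((hasDerivAt_affine b c).mul (hasDerivAt_affine b c)).congr_deriv ?_
    simp only [zero_mul, add_zero]
    ring
  have h1 : ∀ a b c d, fderiv ℝ Θ₁ (a, b, c) (1, c, d) = 2 * (c * c + b * d) := by
    intro a b c d
    refine fderiv_apply_eq_of_hasDerivAt (hΘ₁s.differentiable (by simp) _) ?_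
    refine (((hasDerivAt_affine b c).mul (hasDerivAt_affine c d)).const_mul 2).congr_deriv ?_
    simp
  have key := fun {Θ : ℝ × ℝ × ℝ → ℝ} (hΘ : ContDiff ℝ 1 Θ) (s : ℝ) (hs : 0 < s) =>
    h.hasFDerivAt_integral_jet (isOpen_posOrth n) i hΘ (hγs s hs)
  refine monotoneOn_div_sq (D := D)
    (G₁ := fun s => ∫ z in Icc (0:ℝ) 1, 2 * (ψ (γ s) z * fderiv ℝ (fun y => ψ y z) (γ s) e))
    (G₂ := fun s => ∫ z in Icc (0:ℝ) 1,
      2 * (fderiv ℝ (fun y => ψ y z) (γ s) e * fderiv ℝ (fun y => ψ y z) (γ s) e +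
        ψ (γ s) z * dir2 (fun y => ψ y z) (γ s) e)) ?_ ?_ ?_ ?_
  · intro s hs
    obtain ⟨-, L, hL, -, hLe⟩ := key hΘ₀s s hs
    have h2 := hL.comp_hasDerivAt s (hγd s)
    rw [hLe] at h2
    simp only [jet, h0] at h2
    simpa only [hΘ₀, Function.comp_def, sq] using h2
  · intro s hs
    obtain ⟨-, L, hL, -, hLe⟩ := key hΘ₁s s hs
    have h2 := hL.comp_hasDerivAt s (hγd s)
    rw [hLe] at h2
    simp only [jet, h1] at h2
    simpa only [hΘ₁, Function.comp_def] using h2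
  · intro s hs
    obtain ⟨i0, -⟩ := key hΘ₀s s hs
    obtain ⟨i1, L, -, i2, -⟩ := key hΘ₁s s hs
    obtain ⟨i3, -⟩ := key hΘ₂s s hs
    simp only [jet, h1, ← he] at i2
    simp only [jet, hΘ₀] at i0
    simp only [jet, hΘ₁, ← he] at i1
    simp only [jet, hΘ₂, ← he] at i3
    simp only [sq (ψ _ _)]
    have i5 : Integrable (fun z => s ^ 2 *
        (2 * (fderiv ℝ (fun y => ψ y z) (γ s) e * fderiv ℝ (fun y => ψ y z) (γ s) e +
          ψ (γ s) z * dir2 (fun y => ψ y z) (γ s) e)) -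
        2 * s * (2 * (ψ (γ s) z * fderiv ℝ (fun y => ψ y z) (γ s) e)))
        (volume.restrict (Icc (0:ℝ) 1)) :=
      (i2.const_mul (s ^ 2)).sub (i1.const_mul (2 * s))
    rw [← integral_const_mul, ← integral_const_mul, ← integral_const_mul,
      ← integral_sub (i2.const_mul (s ^ 2)) (i1.const_mul (2 * s)),
      ← integral_add i5 (i0.const_mul 2)]
    have i4 : Integrable (fun z => 2 * s ^ 2 * (ψ (γ s) z * dir2 (fun y => ψ y z) (γ s) e))
        (volume.restrict (Icc (0:ℝ) 1)) := by
      refine ((i2.const_mul (s ^ 2)).sub (i3.const_mul (2 * s ^ 2))).congr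
        (Filter.Eventually.of_forall fun z => ?_)
      simp only [Pi.sub_apply]
      ring
    have h3 : 0 ≤ ∫ z in Icc (0:ℝ) 1,
        2 * s ^ 2 * (ψ (γ s) z * dir2 (fun y => ψ y z) (γ s) e) := by
      rw [integral_const_mul]
      exact mul_nonneg (by positivity) (hnn _ (hγs s hs))
    refine h3.trans (integral_mono i4 (i5.add (i0.const_mul 2)) fun z => ?_)
    dsimp only
    nlinarith [sq_nonneg (s * fderiv ℝ (fun y => ψ y z) (γ s) e - ψ (γ s) z)]
  · intro s hs
    obtain ⟨i0, -⟩ := key hΘ₀s s hs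
    simp only [jet, hΘ₀, ← sq] at i0
    have h2 : ∫ z in Icc (0:ℝ) 1, (ψ (γ s) z) ^ 2 ≤ ∫ z in Icc (0:ℝ) 1, D * s ^ 2 := by
      refine setIntegral_mono_on i0 (integrable_const _) measurableSet_Icc fun z hz => ?_
      simpa [hγ] using hD (γ s) (hγs s hs) z hz
    simpa using h2

/-- Theorem 6.2: assume that for each fixed `(x,t)` the map `z ↦ φ(x,t,z)` takes at most
finitely many values and that `B` is LCP at every point of `(0,∞)ⁿ × [0,T]`. Then for
each `i` and each fixed `t ∈ [0,T]`, the jump volatility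
`x ↦ √( λ(t)² ∫₀¹ φ_i(x,t,z)² dz / x_i² )` of the `i`-th asset is nondecreasing in `x_i`
(the other coordinates being held fixed). -/
theorem jumpVol_monotone_of_lcp {n : ℕ} {T : ℝ} (hT : 0 < T)
    (K : JumpKernel n T) (hK : K.AENonzero)
    (hfin : ∀ x ∈ posOrth n, ∀ t ∈ Set.Icc (0:ℝ) T,
      ((fun z => K.φ x t z) '' Set.Icc (0:ℝ) 1).Finite)
    (lam : ℝ → ℝ) (hlam : LamOK T lam)
    (hlampos : ∀ s ∈ Set.Icc (0:ℝ) T, 0 < lam s)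
    (hLCP : ∀ x ∈ posOrth n, ∀ t ∈ Set.Icc (0:ℝ) T, IsLCPAt (Bop lam K) x t) :
    ∀ i : Fin n, ∀ t ∈ Set.Icc (0:ℝ) T, ∀ x ∈ posOrth n, ∀ y ∈ posOrth n,
      (∀ k, k ≠ i → x k = y k) → x i ≤ y i →
      Real.sqrt ((lam t) ^ 2 * (∫ z in Icc (0:ℝ) 1, (K.φ x t z i) ^ 2) / (x i) ^ 2) ≤
        Real.sqrt ((lam t) ^ 2 * (∫ z in Icc (0:ℝ) 1, (K.φ y t z i) ^ 2) / (y i) ^ 2) := by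
  intro i t ht x hx y hy hxy hle
  obtain ⟨D, -, hD⟩ := K.bound
  have hmono := (K.uniformC2 ht i).monotoneOn_integral_sq_div_sq i
    (fun x hx z hz => hD x hx t ht z hz i)
    (fun x hx => integral_mul_dir2_nonneg K hx ht (hlampos t ht) (hfin x hx t ht)
      (hLCP x hx t ht) i) hx (hx i) (hy i) hle
  have hy' : Function.update x i (y i) = y := by
    funext k
    rcases eq_or_ne k i with rfl | hk
    · simp
    · simp [hk, hxy k hk]
  simp only [Function.update_eq_self, hy'] at hmono
  rw [mul_div_assoc, mul_div_assoc]
  exact Real.sqrt_le_sqrt (mul_le_mul_of_nonneg_left hmono (sq_nonneg _))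

end
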